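/- Let A(t) be an n×l real matrix function of class C¹ on [a,b] with l ≤ n, and set B(t) = A(t)ᵀA(t). Suppose det B(t) ≠ 0 for t ∈ (a,b), det B(b) = 0, and there exists h_b > 0 such that det B(b+t) = h_b² t² + o(t²) as t → 0−. Then the function μA(t) = min_{|v|=1} |A(t)v| is continuously differentiable on (b−δ, b] for some δ > 0, and its left derivative at t = b equals −h_b/√Λ_b, where Λ_b is the product of the nonzero eigenvalues of B(b). -/

import Mathlib

open Set Filter Asymptotics Topology MeasureTheory Matrix

/-- Euclidean norm of a vector in `ℝˡ`. -/
noncomputable def euclNorm {l : ℕ} (v : Fin l → ℝ) : ℝ := Real.sqrt (∑ i, v i ^ 2)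

/-- The mininorm `μ(A) = min_{|v| = 1} |Av|` of an `n × l` matrix. -/
noncomputable def muNorm {n l : ℕ} (M : Matrix (Fin n) (Fin l) ℝ) : ℝ :=
  sInf ((fun v => euclNorm (M.mulVec v)) '' {v : Fin l → ℝ | euclNorm v = 1})


lemma ext_C1 {a b : ℝ} (hab : a < b) {f : ℝ → ℝ} (hf : ContDiffOn ℝ 1 f (Set.Icc a b)) :
    ∃ g : ℝ → ℝ, ContDiff ℝ 1 g ∧ ∀ t ∈ Set.Icc a b, g t = f t := by
  have hd := (contDiffOn_one_iff_derivWithin (uniqueDiffOn_Icc hab)).1 hf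
  set k : ℝ → ℝ := Set.IccExtend hab.le (fun x : Set.Icc a b => derivWithin f (Set.Icc a b) x)
    with hk
  have hkc : Continuous k := by
    apply Continuous.Icc_extend'
    exact continuousOn_iff_continuous_domRestrict.1 hd.2
  refine ⟨fun t => f a + ∫ s in a..t, k s, ?_, ?_⟩
  · have h : ∀ t, HasDerivAt (fun t => f a + ∫ s in a..t, k s) (k t) t := fun t =>
      (intervalIntegral.integral_hasDerivAt_right (hkc.intervalIntegrable _ _)
        hkc.stronglyMeasurable.stronglyMeasurableAtFilter hkc.continuousAt).const_add _
    rw [contDiff_one_iff_deriv]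
    refine ⟨fun t => (h t).differentiableAt, ?_⟩
    rw [show deriv (fun t => f a + ∫ s in a..t, k s) = k from funext fun t => (h t).deriv]
    exact hkc
  · intro t ht
    have := intervalIntegral.integral_eq_sub_of_hasDerivAt_of_le (f := f) (f' := k) ht.1
      (hf.continuousOn.mono (Set.Icc_subset_Icc_right ht.2)) (fun x hx => ?_)
      (hkc.intervalIntegrable _ _)
    · simp only [this]; ring
    · have hx' : x ∈ Set.Icc a b := ⟨hx.1.le, hx.2.le.trans ht.2⟩
      rw [hk, Set.IccExtend_of_mem _ _ hx']
      exact (hd.1 x hx').hasDerivWithinAt.hasDerivAt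
        (Icc_mem_nhds hx.1 (hx.2.trans_le ht.2))

lemma norm_curve {E : Type*} [NormedAddCommGroup E] [InnerProductSpace ℝ E] {w : ℝ → E} {b : ℝ}
    (hw : ContDiffAt ℝ 1 w b) (hwb : w b = 0) (hd : deriv w b ≠ 0) :
    ∃ δ > 0, ContDiffOn ℝ 1 (fun t => ‖w t‖) (Set.Ioc (b - δ) b) ∧
      HasDerivWithinAt (fun t => ‖w t‖) (-‖deriv w b‖) (Set.Iic b) b := by
  have hwd : HasDerivAt w (deriv w b) b := (hw.differentiableAt one_ne_zero).hasDerivAt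
  have hslope : Tendsto (slope w b) (𝓝[<] b) (𝓝 (deriv w b)) :=
    (hasDerivAt_iff_tendsto_slope.1 hwd).mono_left
      (nhdsWithin_mono _ (fun x hx => ne_of_lt hx))
  have hsl : ∀ t, t < b → ‖slope w b t‖ = ‖w t‖ / (b - t) := by
    intro t ht
    rw [slope_def_module, norm_smul, hwb, sub_zero, norm_inv, Real.norm_eq_abs, abs_sub_comm,
      abs_of_pos (sub_pos.2 ht)]
    field_simp
  have hderb : HasDerivWithinAt (fun t => ‖w t‖) (-‖deriv w b‖) (Set.Iic b) b := by
    rw [hasDerivWithinAt_iff_tendsto_slope]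
    have hs : Set.Iic b \ {b} = Set.Iio b := by ext; simp [lt_iff_le_and_ne]
    rw [hs]
    refine hslope.norm.neg.congr' ?_
    filter_upwards [self_mem_nhdsWithin] with t ht
    rw [hsl t ht, slope_def_field, hwb, norm_zero, sub_zero, ← neg_sub b t, div_neg]
  have e1 : ∀ᶠ t in 𝓝 b, ContDiffAt ℝ 1 w t := hw.eventually (by simp)
  have e2 : ∀ᶠ t in 𝓝 b, t ≠ b → w t ≠ 0 := by
    have := hwd.eventually_ne (c := (0 : E)) hd
    rwa [eventually_nhdsWithin_iff] at this
  obtain ⟨δ, hδ, hball⟩ := Metric.eventually_nhds_iff.1 (e1.and e2)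
  have hS : ∀ t ∈ Set.Ioc (b - δ) b, ContDiffAt ℝ 1 w t ∧ (t ≠ b → w t ≠ 0) := by
    intro t ht
    apply hball
    rw [Real.dist_eq, abs_lt]
    constructor <;> linarith [ht.1, ht.2]
  refine ⟨δ, hδ, ?_, hderb⟩
  have huniq : UniqueDiffOn ℝ (Set.Ioc (b - δ) b) := uniqueDiffOn_Ioc _ _
  set m : ℝ → ℝ := fun t => if t < b then inner ℝ (w t) (deriv w t) / ‖w t‖ else -‖deriv w b‖
    with hm
  have hder0 : ∀ t ∈ Set.Ioo (b - δ) b,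
      HasDerivAt (fun t => ‖w t‖) (inner ℝ (w t) (deriv w t) / ‖w t‖) t := by
    intro t ht
    obtain ⟨h1, h2⟩ := hS t ⟨ht.1, ht.2.le⟩
    have hne := norm_ne_zero_iff.2 (h2 ht.2.ne)
    have h3 := (h1.differentiableAt one_ne_zero).hasDerivAt.norm_sq
    have h4 := h3.sqrt (by positivity)
    simp only [Real.sqrt_sq (norm_nonneg _)] at h4
    convert h4 using 1
    field_simp
  have hder : ∀ t ∈ Set.Ioc (b - δ) b,
      HasDerivWithinAt (fun t => ‖w t‖) (m t) (Set.Ioc (b - δ) b) t := by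
    intro t ht
    rcases lt_or_eq_of_le ht.2 with h | rfl
    · simp only [hm, h, if_true]
      exact (hder0 t ⟨ht.1, h⟩).hasDerivWithinAt
    · simp only [hm, lt_irrefl, if_false]
      exact hderb.mono (fun x hx => hx.2)
  rw [contDiffOn_one_iff_derivWithin huniq]
  refine ⟨fun t ht => (hder t ht).differentiableWithinAt, ?_⟩
  have hcong : Set.EqOn (derivWithin (fun t => ‖w t‖) (Set.Ioc (b - δ) b)) m
    (Set.Ioc (b - δ) b) := fun t ht => (hder t ht).derivWithin (huniq t ht)
  refine ContinuousOn.congr ?_ hcong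
  have hdc : ∀ t ∈ Set.Ioc (b - δ) b, ContinuousAt (deriv w) t := by
    intro t ht
    exact ((hS t ht).1.derivWithin (m := 0) (by simp)).continuousAt
  intro t ht
  rcases lt_or_eq_of_le ht.2 with h | h
  · apply ContinuousAt.continuousWithinAt
    have hc : ContinuousAt (fun t => inner ℝ (w t) (deriv w t) / ‖w t‖) t := by
      have hwc := (hS t ht).1.continuousAt
      exact (hwc.inner (hdc t ht)).div hwc.norm (norm_ne_zero_iff.2 ((hS t ht).2 h.ne))
    refine hc.congr ?_
    filter_upwards [Iio_mem_nhds h] with s hs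
    simp only [hm]
    rw [if_pos (show s < b from hs)]
  · subst h
    have key : Tendsto m (𝓝[<] t) (𝓝 (m t)) := by
      have hmt : m t = - (inner ℝ (deriv w t) (deriv w t) / ‖deriv w t‖) := by
        simp only [hm, lt_irrefl, if_false]
        rw [real_inner_self_eq_norm_sq]
        have := norm_ne_zero_iff.2 hd
        field_simp
      rw [hmt]
      have := ((hslope.inner ((hdc t ht).tendsto.mono_left nhdsWithin_le_nhds)).div hslope.norm
        (norm_ne_zero_iff.2 hd)).neg
      refine this.congr' ?_
      filter_upwards [self_mem_nhdsWithin] with s hs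
      have hs' : s < t := hs
      simp only [hm, if_pos hs']
      rw [Pi.div_apply, hsl s hs', slope_def_module, hwb, sub_zero, real_inner_smul_left, ← neg_sub t s,
        inv_neg]
      have : t - s ≠ 0 := (sub_pos.2 hs').ne'
      by_cases hz : ‖w s‖ = 0
      · simp [hz]
      · field_simp
    have h2 : ContinuousWithinAt m (Set.Iic t) t := by
      rw [← Set.Iio_insert, continuousWithinAt_insert_self]
      exact key
    exact h2.mono (fun x hx => hx.2)

lemma euclNorm_sq {l : ℕ} (v : Fin l → ℝ) : euclNorm v ^ 2 = v ⬝ᵥ v := by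
  unfold euclNorm
  rw [Real.sq_sqrt (Finset.sum_nonneg fun i _ => sq_nonneg _)]
  simp [dotProduct, sq]

lemma euclNorm_nonneg {l : ℕ} (v : Fin l → ℝ) : 0 ≤ euclNorm v := Real.sqrt_nonneg _

lemma euclNorm_eq_norm {l : ℕ} (v : Fin l → ℝ) : euclNorm v = ‖WithLp.toLp 2 v‖ := by
  rw [EuclideanSpace.norm_eq]; simp [euclNorm]

lemma euclNorm_smul {l : ℕ} (c : ℝ) (v : Fin l → ℝ) : euclNorm (c • v) = |c| * euclNorm v := by
  rw [euclNorm_eq_norm, euclNorm_eq_norm, WithLp.toLp_smul, norm_smul, Real.norm_eq_abs]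

lemma euclNorm_pos {l : ℕ} {v : Fin l → ℝ} (h : v ≠ 0) : 0 < euclNorm v := by
  rw [euclNorm_eq_norm, norm_pos_iff]
  simpa using h

lemma continuous_euclNorm {l : ℕ} : Continuous (euclNorm : (Fin l → ℝ) → ℝ) := by
  unfold euclNorm; fun_prop

lemma muNorm_bdd {n l : ℕ} (M : Matrix (Fin n) (Fin l) ℝ) :
    BddBelow ((fun v => euclNorm (M.mulVec v)) '' {v : Fin l → ℝ | euclNorm v = 1}) :=
  ⟨0, by rintro _ ⟨v, _, rfl⟩; exact euclNorm_nonneg _⟩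

lemma muNorm_nonneg {n l : ℕ} (M : Matrix (Fin n) (Fin l) ℝ) : 0 ≤ muNorm M :=
  Real.sInf_nonneg (by rintro _ ⟨v, _, rfl⟩; exact euclNorm_nonneg _)

lemma muNorm_le {n l : ℕ} (M : Matrix (Fin n) (Fin l) ℝ) {v : Fin l → ℝ} (hv : euclNorm v = 1) :
    muNorm M ≤ euclNorm (M.mulVec v) := csInf_le (muNorm_bdd M) ⟨v, hv, rfl⟩

lemma muNorm_le' {n l : ℕ} (M : Matrix (Fin n) (Fin l) ℝ) (v : Fin l → ℝ) :
    muNorm M * euclNorm v ≤ euclNorm (M.mulVec v) := by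
  by_cases h : v = 0
  · subst h; simp [euclNorm]
  have hp := euclNorm_pos h
  have h1 := muNorm_le M (v := (euclNorm v)⁻¹ • v) (by
    rw [euclNorm_smul, abs_of_pos (inv_pos.2 hp)]; field_simp)
  rw [Matrix.mulVec_smul, euclNorm_smul, abs_of_pos (inv_pos.2 hp)] at h1
  calc _ ≤ _ := mul_le_mul_of_nonneg_right h1 hp.le
    _ = _ := by field_simp

lemma dot_gram {n l : ℕ} (M : Matrix (Fin n) (Fin l) ℝ) (v : Fin l → ℝ) :
    v ⬝ᵥ ((Mᵀ * M) *ᵥ v) = euclNorm (M.mulVec v) ^ 2 := by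
  rw [euclNorm_sq, ← Matrix.mulVec_mulVec, Matrix.dotProduct_mulVec, Matrix.vecMul_transpose]

lemma muNorm_det {n l : ℕ} (hl : 0 < l) (M : Matrix (Fin n) (Fin l) ℝ) :
    (Mᵀ * M - muNorm M ^ 2 • (1 : Matrix (Fin l) (Fin l) ℝ)).det = 0 := by
  have hcomp : IsCompact {v : Fin l → ℝ | euclNorm v = 1} := by
    apply Metric.isCompact_of_isClosed_isBounded
    · exact isClosed_eq continuous_euclNorm continuous_const
    · rw [isBounded_iff_forall_norm_le]
      refine ⟨1, fun v hv => ?_⟩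
      rw [pi_norm_le_iff_of_nonneg zero_le_one]
      intro i
      have := PiLp.norm_apply_le (WithLp.toLp 2 v) i
      rw [← euclNorm_eq_norm, hv] at this
      exact this
  have hne : {v : Fin l → ℝ | euclNorm v = 1}.Nonempty := by
    refine ⟨Pi.single ⟨0, hl⟩ 1, ?_⟩
    simp [euclNorm, Pi.single_apply]
  have hcont : Continuous (fun v : Fin l → ℝ => euclNorm (M.mulVec v)) :=
    continuous_euclNorm.comp (by fun_prop)
  obtain ⟨v, hv, hmin⟩ := hcomp.exists_sInf_image_eq hne hcont.continuousOn
  change muNorm M = _ at hmin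
  set S := Mᵀ * M - muNorm M ^ 2 • (1 : Matrix (Fin l) (Fin l) ℝ) with hS
  have hq : ∀ x : Fin l → ℝ, x ⬝ᵥ (S *ᵥ x) =
      euclNorm (M.mulVec x) ^ 2 - muNorm M ^ 2 * euclNorm x ^ 2 := by
    intro x
    rw [hS, Matrix.sub_mulVec, dotProduct_sub, dot_gram, Matrix.smul_mulVec, Matrix.one_mulVec,
      dotProduct_smul, euclNorm_sq x, smul_eq_mul]
  have hpsd : S.PosSemidef := by
    rw [Matrix.posSemidef_iff_dotProduct_mulVec]
    refine ⟨?_, fun x => ?_⟩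
    · rw [hS]
      simp [Matrix.IsHermitian, Matrix.conjTranspose_eq_transpose_of_trivial]
    · rw [star_trivial, hq, sub_nonneg, ← mul_pow]
      exact pow_le_pow_left₀ (mul_nonneg (muNorm_nonneg _) (euclNorm_nonneg _)) (muNorm_le' M x) 2
  have h0 : S *ᵥ v = 0 := by
    rw [← hpsd.dotProduct_mulVec_zero_iff, star_trivial, hq, hmin, hv]; ring
  rw [← Matrix.exists_mulVec_eq_zero_iff]
  refine ⟨v, ?_, h0⟩
  rintro rfl
  simp [euclNorm] at hv

lemma muNorm_mul_orth {n l : ℕ} (M : Matrix (Fin n) (Fin l) ℝ) (Q : Matrix (Fin l) (Fin l) ℝ)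
    (h1 : Qᵀ * Q = 1) : muNorm (M * Q) = muNorm M := by
  have h2 : Q * Qᵀ = 1 := mul_eq_one_comm.1 h1
  have hn : ∀ P : Matrix (Fin l) (Fin l) ℝ, Pᵀ * P = 1 → ∀ v, euclNorm (P *ᵥ v) = euclNorm v := by
    intro P hP v
    rw [← sq_eq_sq₀ (euclNorm_nonneg _) (euclNorm_nonneg _), ← dot_gram, hP, Matrix.one_mulVec,
      euclNorm_sq]
  unfold muNorm
  congr 1
  ext y
  constructor
  · rintro ⟨v, hv, rfl⟩
    exact ⟨Q *ᵥ v, (hn Q h1 v).trans hv, by simp [Matrix.mulVec_mulVec]⟩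
  · rintro ⟨v, hv, rfl⟩
    refine ⟨Qᵀ *ᵥ v, (hn Qᵀ (by simpa using h2) v).trans hv, ?_⟩
    simp [Matrix.mulVec_mulVec, Matrix.mul_assoc, h2]

lemma contDiffAt_det {E : Type*} [NormedAddCommGroup E] [NormedSpace ℝ E] {l : ℕ}
    {X : E → Matrix (Fin l) (Fin l) ℝ} {x : E}
    (h : ∀ i j, ContDiffAt ℝ 1 (fun t => X t i j) x) : ContDiffAt ℝ 1 (fun t => (X t).det) x := by
  simp only [Matrix.det_apply]
  apply ContDiffAt.sum
  intro σ _
  apply ContDiffAt.const_smul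
  apply contDiffAt_prod
  intro i _
  exact h _ _

lemma contDiffAt_adj {E : Type*} [NormedAddCommGroup E] [NormedSpace ℝ E] {l : ℕ}
    {X : E → Matrix (Fin l) (Fin l) ℝ} {x : E}
    (h : ∀ i j, ContDiffAt ℝ 1 (fun t => X t i j) x) (i j : Fin l) :
    ContDiffAt ℝ 1 (fun t => (X t).adjugate i j) x := by
  simp only [Matrix.adjugate_apply]
  apply contDiffAt_det
  intro p q
  simp only [Matrix.updateRow_apply]
  split_ifs
  · exact contDiffAt_const
  · exact h _ _

lemma simple_kernel {n l : ℕ} (A : ℝ → Matrix (Fin n) (Fin l) ℝ) (b : ℝ)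
    (hA : ∀ i j, DifferentiableAt ℝ (fun t => A t i j) b) (d : Fin l → ℝ)
    (hd : (A b)ᵀ * A b = diagonal d) (h0 : ∃ i, d i = 0) (hb : ℝ) (hhb : 0 < hb)
    (hlim : Tendsto (fun t => ((A t)ᵀ * A t).det / (t - b) ^ 2) (𝓝[<] b) (𝓝 (hb ^ 2))) :
    ∃ i₀, ∀ i, d i = 0 ↔ i = i₀ := by
  have hcol : ∀ i j, d j = 0 → A b i j = 0 := by
    intro i j hj
    have h1 : ((A b)ᵀ * A b) j j = 0 := by rw [hd]; simp [hj]
    rw [Matrix.mul_apply] at h1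
    simp only [Matrix.transpose_apply] at h1
    rw [Finset.sum_eq_zero_iff_of_nonneg (fun i _ => mul_self_nonneg _)] at h1
    exact mul_self_eq_zero.1 (h1 i (Finset.mem_univ _))
  set K := Finset.univ.filter (fun i => d i = 0) with hK
  set E : ℝ → Matrix (Fin n) (Fin l) ℝ := fun t => Matrix.of fun i j =>
    if d j = 0 then (t - b)⁻¹ * A t i j else A t i j with hE
  set L : Matrix (Fin n) (Fin l) ℝ := Matrix.of fun i j =>
    if d j = 0 then deriv (fun t => A t i j) b else A b i j with hL
  have hEL : Tendsto E (𝓝[<] b) (𝓝 L) := by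
    refine tendsto_pi_nhds.2 fun i => tendsto_pi_nhds.2 fun j => ?_
    simp only [hE, hL, Matrix.of_apply]
    by_cases hj : d j = 0
    · simp only [hj, if_true]
      have := (hasDerivAt_iff_tendsto_slope.1 (hA i j).hasDerivAt).mono_left
        (nhdsWithin_mono b (fun x (hx : x < b) => ne_of_lt hx))
      refine this.congr fun t => ?_
      rw [slope_def_module, hcol i j hj, sub_zero, smul_eq_mul]
    · simp only [hj, if_false]
      exact (hA i j).continuousAt.tendsto.mono_left nhdsWithin_le_nhds
  have hdetlim : Tendsto (fun t => ((E t)ᵀ * E t).det) (𝓝[<] b) (𝓝 ((Lᵀ * L).det)) := by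
    have hc : Continuous (fun M : Matrix (Fin n) (Fin l) ℝ => (Mᵀ * M).det) := by fun_prop
    exact (hc.tendsto L).comp hEL
  have hfac : ∀ t, t < b → ((A t)ᵀ * A t).det = ((t - b) ^ K.card) ^ 2 * ((E t)ᵀ * E t).det := by
    intro t ht
    have hne : t - b ≠ 0 := (sub_neg.2 ht).ne
    set c : Fin l → ℝ := fun j => if d j = 0 then t - b else 1 with hc
    have h1 : A t = E t * diagonal c := by
      ext i j
      rw [Matrix.mul_diagonal]
      simp only [hE, hc, Matrix.of_apply]
      split_ifs
      · field_simp
      · ring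
    have h2 : ∏ j, c j = (t - b) ^ K.card := by
      simp only [hc, hK]
      rw [Finset.prod_ite]; simp
    rw [h1, Matrix.transpose_mul, Matrix.diagonal_transpose, Matrix.mul_assoc,
      ← Matrix.mul_assoc (E t)ᵀ, Matrix.det_mul, Matrix.det_mul, Matrix.det_diagonal, h2]
    ring
  have hcard : K.card = 1 := by
    have hpos : 0 < K.card := by
      obtain ⟨i, hi⟩ := h0
      exact Finset.card_pos.2 ⟨i, by simp [hK, hi]⟩
    by_contra hne
    obtain ⟨k, hk⟩ : ∃ k, K.card = k + 2 := ⟨K.card - 2, by omega⟩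
    have hz : Tendsto (fun t => ((t - b) ^ (k + 1)) ^ 2 * ((E t)ᵀ * E t).det) (𝓝[<] b)
        (𝓝 (((b - b) ^ (k + 1)) ^ 2 * (Lᵀ * L).det)) := by
      refine Tendsto.mul ?_ hdetlim
      have : Continuous (fun t : ℝ => ((t - b) ^ (k + 1)) ^ 2) := by fun_prop
      exact this.continuousAt.tendsto.mono_left nhdsWithin_le_nhds
    have hz' := tendsto_nhds_unique hlim (hz.congr' (by
      filter_upwards [self_mem_nhdsWithin] with t ht
      have hne : t - b ≠ 0 := (sub_neg.2 ht).ne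
      rw [hfac t ht, hk]
      field_simp
      ring))
    have : hb ^ 2 = 0 := by rw [hz']; simp
    exact (pow_pos hhb 2).ne' this
  obtain ⟨i₀, hi₀⟩ := Finset.card_eq_one.1 hcard
  refine ⟨i₀, fun i => ?_⟩
  have : i ∈ K ↔ i ∈ ({i₀} : Finset (Fin l)) := by rw [hi₀]
  simpa [hK] using this

lemma core {n l : ℕ} (A : ℝ → Matrix (Fin n) (Fin l) ℝ) (b : ℝ)
    (hA : ∀ i j, ContDiff ℝ 1 (fun t => A t i j)) (d : Fin l → ℝ)
    (hd : (A b)ᵀ * A b = diagonal d) (h0 : ∃ i, d i = 0) (hb : ℝ) (hhb : 0 < hb)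
    (hlim : Tendsto (fun t => ((A t)ᵀ * A t).det / (t - b) ^ 2) (𝓝[<] b) (𝓝 (hb ^ 2))) :
    ∃ δ > 0, ContDiffOn ℝ 1 (fun t => muNorm (A t)) (Set.Ioc (b - δ) b) ∧
      HasDerivWithinAt (fun t => muNorm (A t))
        (-(hb / Real.sqrt (∏ i ∈ Finset.univ.filter fun i => d i ≠ 0, d i))) (Set.Iic b) b := by
  obtain ⟨i₀, hi₀⟩ := simple_kernel A b
    (fun i j => (hA i j).contDiffAt.differentiableAt one_ne_zero) d hd h0 hb hhb hlim
  have hl : 0 < l := i₀.pos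
  have hdnn : ∀ i, 0 ≤ d i := by
    intro i
    have h1 : ((A b)ᵀ * A b) i i = d i := by rw [hd]; simp
    rw [← h1, Matrix.mul_apply]
    exact Finset.sum_nonneg fun j _ => mul_self_nonneg _
  have hfil : (Finset.univ.filter fun i => d i ≠ 0) = Finset.univ.erase i₀ := by
    ext i; simp [hi₀]
  rw [hfil]
  set Λ := ∏ i ∈ Finset.univ.erase i₀, d i with hΛ
  have hΛpos : 0 < Λ := Finset.prod_pos fun i hi =>
    lt_of_le_of_ne (hdnn i) (Ne.symm (fun h => (Finset.mem_erase.1 hi).1 ((hi₀ i).1 h)))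
  -- the characteristic determinant
  have hBc : ∀ i j, ContDiff ℝ 1 (fun t => ((A t)ᵀ * A t) i j) := by
    intro i j
    simp only [Matrix.mul_apply, Matrix.transpose_apply]
    exact ContDiff.sum fun k _ => (hA k i).mul (hA k j)
  set F : ℝ × ℝ → ℝ := fun p =>
    ((A p.1)ᵀ * A p.1 - p.2 • (1 : Matrix (Fin l) (Fin l) ℝ)).det with hF
  have hFc : ContDiffAt ℝ 1 F (b, 0) := by
    apply contDiffAt_det
    intro i j
    simp only [Matrix.sub_apply, Matrix.smul_apply, smul_eq_mul]
    exact (((hBc i j).comp contDiff_fst).sub (contDiff_snd.mul contDiff_const)).contDiffAt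
  have hFb : ∀ x, F (b, x) = ∏ i, (d i - x) := by
    intro x
    simp only [hF, hd]
    rw [← Matrix.diagonal_one, ← Matrix.diagonal_smul, Matrix.diagonal_sub, Matrix.det_diagonal]
    simp
  have hd0 : d i₀ = 0 := (hi₀ i₀).2 rfl
  have hFb0 : F (b, 0) = 0 := by
    rw [hFb]; exact Finset.prod_eq_zero (Finset.mem_univ i₀) (by simp [hd0])
  have hFx : fderiv ℝ F (b, 0) (0, 1) = -Λ := by
    have h1 : HasDerivAt (fun x : ℝ => F (b, x)) (fderiv ℝ F (b, 0) (0, 1)) 0 := by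
      have h2 : HasDerivAt (fun x : ℝ => ((b, x) : ℝ × ℝ)) (0, 1) 0 :=
        (hasDerivAt_const _ _).prodMk (hasDerivAt_id _)
      exact (hFc.differentiableAt one_ne_zero).hasFDerivAt.comp_hasDerivAt (0 : ℝ) h2
    have h3 : HasDerivAt (fun x : ℝ => F (b, x)) (-Λ) 0 := by
      have h4 : (fun x : ℝ => F (b, x)) =
          fun x => (-x) * ∏ i ∈ Finset.univ.erase i₀, (d i - x) := by
        ext x
        rw [hFb, ← Finset.mul_prod_erase _ _ (Finset.mem_univ i₀), hd0, zero_sub]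
      rw [h4]
      have h5 : DifferentiableAt ℝ (fun x => ∏ i ∈ Finset.univ.erase i₀, (d i - x)) 0 := by
        fun_prop
      have := (hasDerivAt_neg (0 : ℝ)).mul h5.hasDerivAt
      refine this.congr_deriv ?_
      simp [hΛ]
    exact h1.unique h3
  have hinv : (fderiv ℝ F (b, 0) ∘L .inr ℝ ℝ ℝ).IsInvertible := by
    refine ⟨ContinuousLinearEquiv.unitsEquivAut ℝ (Units.mk0 (-Λ) (neg_ne_zero.2 hΛpos.ne')), ?_⟩
    ext
    simp [hFx]
  set φ := hFc.implicitFunction one_ne_zero hinv with hφ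
  have hφc : ContDiffAt ℝ 1 φ b := hFc.contDiffAt_implicitFunction one_ne_zero hinv
  have hφb : φ b = 0 := hFc.implicitFunction_apply_self one_ne_zero hinv
  have hφF : ∀ᶠ t in 𝓝 b, F (t, φ t) = 0 := by
    have := hFc.eventually_apply_implicitFunction one_ne_zero hinv
    rwa [hFb0] at this
  have hAcont : Continuous A :=
    continuous_pi fun i => continuous_pi fun j => (hA i j).continuous
  have hcolb : euclNorm (A b *ᵥ Pi.single i₀ 1) = 0 := by
    have := dot_gram (A b) (Pi.single i₀ 1)
    rw [hd] at this
    have h2 : euclNorm (A b *ᵥ Pi.single i₀ 1) ^ 2 = 0 := by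
      rw [← this]; simp [hd0]
    exact pow_eq_zero_iff (two_ne_zero) |>.1 h2
  have hmulim : Tendsto (fun t => muNorm (A t)) (𝓝 b) (𝓝 0) := by
    have hc : Continuous (fun t => euclNorm (A t *ᵥ Pi.single i₀ 1)) :=
      continuous_euclNorm.comp (hAcont.matrix_mulVec continuous_const)
    have h1 := hc.tendsto b
    rw [hcolb] at h1
    refine squeeze_zero (fun t => muNorm_nonneg _) (fun t => muNorm_le (A t) ?_) h1
    simp [euclNorm, Pi.single_apply]
  have hmu : ∀ᶠ t in 𝓝 b, muNorm (A t) ^ 2 = φ t := by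
    have h1 := hFc.eventually_apply_eq_iff_implicitFunction one_ne_zero hinv
    have h2 : Tendsto (fun t => (t, muNorm (A t) ^ 2)) (𝓝 b) (𝓝 (b, 0)) := by
      refine Tendsto.prodMk_nhds tendsto_id ?_
      simpa using hmulim.pow 2
    filter_upwards [h2.eventually h1] with t ht
    refine (ht.1 ?_).symm
    rw [hFb0]
    exact muNorm_det hl (A t)
  -- asymptotics of φ
  have hφlim : Tendsto (fun t => φ t / (t - b) ^ 2) (𝓝[<] b) (𝓝 (hb ^ 2 / Λ)) := by
    have hstrict := (hFc.hasStrictFDerivAt one_ne_zero).isLittleO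
    have hcomp : Tendsto (fun t => (((t, 0), (t, φ t)) : (ℝ × ℝ) × (ℝ × ℝ))) (𝓝 b)
        (𝓝 ((b, 0), (b, 0))) := by
      refine Tendsto.prodMk_nhds (Tendsto.prodMk_nhds tendsto_id tendsto_const_nhds)
        (Tendsto.prodMk_nhds tendsto_id ?_)
      have := hφc.continuousAt.tendsto
      rwa [hφb] at this
    have h1 := hstrict.comp_tendsto hcomp
    have h2 : (fun t => ((A t)ᵀ * A t).det - Λ * φ t) =o[𝓝 b] φ := by
      have h3 : (fun t => ((A t)ᵀ * A t).det - Λ * φ t) =o[𝓝 b]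
          (fun t => (((t, 0) : ℝ × ℝ) - (t, φ t))) := by
        refine h1.congr' ?_ (Eventually.of_forall fun t => rfl)
        filter_upwards [hφF] with t ht
        have e1 : ((t, 0) : ℝ × ℝ) - (t, φ t) = (-φ t) • ((0, 1) : ℝ × ℝ) := by
          ext <;> simp
        simp only [Function.comp]
        rw [ht, e1, map_smul, hFx]
        simp [hF]
        ring
      refine h3.trans_le fun t => ?_
      simp [Prod.norm_def]
    have h4 : (fun t => ((A t)ᵀ * A t).det) ~[𝓝 b] (fun t => Λ * φ t) := by
      refine h2.trans_isBigO ?_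
      exact (isBigO_self_const_mul hΛpos.ne' φ (𝓝 b))
    have h5 := (h4.mono nhdsWithin_le_nhds : _ ~[𝓝[<] b] _).symm.div
      (IsEquivalent.refl (u := fun t => (t - b) ^ 2) (l := 𝓝[<] b))
    have h6 := h5.symm.tendsto_nhds hlim
    have h7 := h6.div_const Λ
    refine h7.congr fun t => ?_
    simp only [Pi.div_apply]
    field_simp
  -- the eigenvector
  set X : ℝ → Matrix (Fin l) (Fin l) ℝ := fun t =>
    (A t)ᵀ * A t - φ t • (1 : Matrix (Fin l) (Fin l) ℝ) with hX
  have hXc : ∀ i j, ContDiffAt ℝ 1 (fun t => X t i j) b := by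
    intro i j
    simp only [hX, Matrix.sub_apply, Matrix.smul_apply, smul_eq_mul]
    exact (hBc i j).contDiffAt.sub (hφc.mul contDiffAt_const)
  set v : ℝ → Fin l → ℝ := fun t j => (X t).adjugate j i₀ with hv
  have hvc : ∀ j, ContDiffAt ℝ 1 (fun t => v t j) b := fun j => contDiffAt_adj hXc j i₀
  have hXv : ∀ t, F (t, φ t) = 0 → X t *ᵥ v t = 0 := by
    intro t ht
    have h1 : X t * (X t).adjugate = 0 := by
      rw [Matrix.mul_adjugate, show (X t).det = 0 from ht, zero_smul]
    ext i
    have h2 := congrFun (congrFun h1 i) i₀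
    rw [Matrix.mul_apply] at h2
    exact h2
  have hvb : v b i₀ = Λ := by
    simp only [hv, hX]
    rw [hd, hφb, zero_smul, sub_zero, Matrix.adjugate_diagonal, Matrix.diagonal_apply_eq]
  have hvbne : v b ≠ 0 := by
    intro h
    rw [h] at hvb
    exact hΛpos.ne hvb
  have hnorm : ∀ t, F (t, φ t) = 0 → euclNorm (A t *ᵥ v t) ^ 2 = φ t * euclNorm (v t) ^ 2 := by
    intro t ht
    have h1 := hXv t ht
    rw [hX] at h1
    simp only [Matrix.sub_mulVec, Matrix.smul_mulVec, Matrix.one_mulVec, sub_eq_zero] at h1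
    rw [← dot_gram, h1, dotProduct_smul, euclNorm_sq, smul_eq_mul]
  have hNc : ContDiffAt ℝ 1 (fun t => euclNorm (v t)) b := by
    unfold euclNorm
    refine ContDiffAt.sqrt ?_ ?_
    · exact ContDiffAt.sum fun i _ => (hvc i).pow 2
    · intro h
      have := euclNorm_pos hvbne
      unfold euclNorm at this
      rw [h] at this
      simp at this
  set w : ℝ → EuclideanSpace ℝ (Fin n) := fun t =>
    WithLp.toLp 2 ((euclNorm (v t))⁻¹ • (A t *ᵥ v t)) with hw
  have hwc : ContDiffAt ℝ 1 w b := by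
    rw [contDiffAt_euclidean]
    intro i
    simp only [hw, Pi.smul_apply, smul_eq_mul, Matrix.mulVec, dotProduct]
    exact (hNc.inv (euclNorm_pos hvbne).ne').mul
      (ContDiffAt.sum fun j _ => (hA i j).contDiffAt.mul (hvc j))
  have hwmu : ∀ᶠ t in 𝓝 b, ‖w t‖ = muNorm (A t) := by
    have e1 : ∀ᶠ t in 𝓝 b, euclNorm (v t) ≠ 0 :=
      hNc.continuousAt.eventually_ne (euclNorm_pos hvbne).ne'
    filter_upwards [e1, hφF, hmu] with t h1 h2 h3
    have hp : 0 < euclNorm (v t) := lt_of_le_of_ne (euclNorm_nonneg _) h1.symm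
    simp only [hw]
    rw [← euclNorm_eq_norm, euclNorm_smul, abs_of_pos (inv_pos.2 hp),
      ← sq_eq_sq₀ (mul_nonneg (inv_pos.2 hp).le (euclNorm_nonneg _)) (muNorm_nonneg _), mul_pow,
      hnorm t h2, h3]
    field_simp
  have hwb : w b = 0 := by
    have h1 := hwmu.self_of_nhds
    have h2 := hmu.self_of_nhds
    rw [hφb, ← h1] at h2
    exact norm_eq_zero.1 (pow_eq_zero_iff two_ne_zero |>.1 h2)
  have hwd : ‖deriv w b‖ = hb / Real.sqrt Λ := by
    have hs : Tendsto (slope w b) (𝓝[<] b) (𝓝 (deriv w b)) :=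
      (hasDerivAt_iff_tendsto_slope.1 (hwc.differentiableAt one_ne_zero).hasDerivAt).mono_left
        (nhdsWithin_mono _ (fun x (hx : x < b) => ne_of_lt hx))
    have h1 : ‖deriv w b‖ ^ 2 = hb ^ 2 / Λ := by
      refine tendsto_nhds_unique (hs.norm.pow 2) (hφlim.congr' ?_)
      filter_upwards [nhdsWithin_le_nhds hwmu, nhdsWithin_le_nhds hmu] with t h1 h2
      rw [slope_def_module, hwb, sub_zero, norm_smul, mul_pow, h1, h2, norm_inv, inv_pow,
        Real.norm_eq_abs, sq_abs]
      ring
    rw [← sq_eq_sq₀ (norm_nonneg _) (by positivity), h1, div_pow, Real.sq_sqrt hΛpos.le]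
  have hwd0 : deriv w b ≠ 0 := by
    rw [← norm_ne_zero_iff, hwd]
    positivity
  obtain ⟨δ, hδ, h1, h2⟩ := norm_curve hwc hwb hwd0
  obtain ⟨ε, hε, hball⟩ := Metric.eventually_nhds_iff.1 hwmu
  refine ⟨min δ ε, lt_min hδ hε, ?_, ?_⟩
  · refine (h1.mono (Set.Ioc_subset_Ioc_left (by linarith [min_le_left δ ε]))).congr ?_
    intro t ht
    refine (hball ?_).symm
    rw [Real.dist_eq, abs_lt]
    constructor <;> linarith [ht.1, ht.2, min_le_right δ ε]
  · rw [← hwd]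
    refine h2.congr_of_eventuallyEq ?_ hwmu.self_of_nhds.symm
    filter_upwards [nhdsWithin_le_nhds hwmu] with t ht
    exact ht.symm
theorem stmt7 (n l : ℕ) (hln : l ≤ n) (a b : ℝ) (hab : a < b)
    (A : ℝ → Matrix (Fin n) (Fin l) ℝ)
    (hA : ∀ i j, ContDiffOn ℝ 1 (fun t => A t i j) (Set.Icc a b))
    (B : ℝ → Matrix (Fin l) (Fin l) ℝ) (hB : ∀ t, B t = (A t)ᵀ * A t)
    (hdet : ∀ t ∈ Set.Ioo a b, (B t).det ≠ 0)
    (hdetb : (B b).det = 0)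
    (hb : ℝ) (hhb : 0 < hb)
    (hasym : (fun t => (B (b + t)).det - hb ^ 2 * t ^ 2) =o[𝓝[<] (0 : ℝ)] fun t => t ^ 2)
    (hHerm : (B b).IsHermitian) :
    ∃ δ > 0, ContDiffOn ℝ 1 (fun t => muNorm (A t)) (Set.Ioc (b - δ) b) ∧
      HasDerivWithinAt (fun t => muNorm (A t))
        (-(hb / Real.sqrt (∏ i ∈ Finset.univ.filter fun i => hHerm.eigenvalues i ≠ 0,
          hHerm.eigenvalues i)))
        (Set.Iic b) b := by
  choose g hgc hg using fun i j => ext_C1 hab (hA i j)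
  set Q : Matrix (Fin l) (Fin l) ℝ := (hHerm.eigenvectorUnitary : Matrix (Fin l) (Fin l) ℝ) with hQ
  have hQQ : Qᵀ * Q = 1 := by
    have := Unitary.coe_star_mul_self hHerm.eigenvectorUnitary
    rwa [Matrix.star_eq_conjTranspose, Matrix.conjTranspose_eq_transpose_of_trivial] at this
  have hspec : B b = Q * diagonal hHerm.eigenvalues * Qᵀ := by
    have := hHerm.spectral_theorem
    rw [Unitary.conjStarAlgAut_apply, Matrix.star_eq_conjTranspose,
      Matrix.conjTranspose_eq_transpose_of_trivial] at this
    exact this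
  set C : ℝ → Matrix (Fin n) (Fin l) ℝ := fun t => (Matrix.of fun i j => g i j t) * Q with hC
  have hCA : ∀ t ∈ Set.Icc a b, C t = A t * Q := by
    intro t ht
    have : (Matrix.of fun i j => g i j t) = A t := by
      ext i j; exact hg i j t ht
    simp only [hC, this]
  have hgram : ∀ t ∈ Set.Icc a b, (C t)ᵀ * C t = Qᵀ * B t * Q := by
    intro t ht
    rw [hCA t ht, hB, Matrix.transpose_mul]
    simp only [Matrix.mul_assoc]
  have hgdet : ∀ t ∈ Set.Icc a b, ((C t)ᵀ * C t).det = (B t).det := by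
    intro t ht
    rw [hgram t ht, Matrix.det_mul, Matrix.det_mul, mul_right_comm, ← Matrix.det_mul, hQQ,
      Matrix.det_one, one_mul]
  have hbmem : b ∈ Set.Icc a b := ⟨hab.le, le_rfl⟩
  have hlim : Tendsto (fun t => ((C t)ᵀ * C t).det / (t - b) ^ 2) (𝓝[<] b) (𝓝 (hb ^ 2)) := by
    have h1 : Tendsto (fun t => (B (b + t)).det / t ^ 2) (𝓝[<] (0 : ℝ)) (𝓝 (hb ^ 2)) := by
      have h2 := (hasym.tendsto_div_nhds_zero).add_const (hb ^ 2)
      rw [zero_add] at h2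
      refine h2.congr' ?_
      filter_upwards [self_mem_nhdsWithin] with t ht
      have : t ≠ 0 := ne_of_lt ht
      field_simp
      ring
    have h3 : Tendsto (fun t => t - b) (𝓝[<] b) (𝓝[<] (0 : ℝ)) := by
      refine tendsto_nhdsWithin_iff.2 ⟨?_, ?_⟩
      · have : Continuous (fun t : ℝ => t - b) := by fun_prop
        have h := this.tendsto b
        rw [sub_self] at h
        exact h.mono_left nhdsWithin_le_nhds
      · filter_upwards [self_mem_nhdsWithin] with t ht
        exact sub_neg.2 (show t < b from ht)
    refine (h1.comp h3).congr' ?_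
    filter_upwards [Ioo_mem_nhdsLT hab] with t ht
    simp only [Function.comp]
    rw [hgdet t ⟨ht.1.le, ht.2.le⟩, add_sub_cancel]
  have hd : (C b)ᵀ * C b = diagonal hHerm.eigenvalues := by
    rw [hgram b hbmem]
    calc Qᵀ * B b * Q = Qᵀ * (Q * diagonal hHerm.eigenvalues * Qᵀ) * Q :=
          congrArg (fun Z => Qᵀ * Z * Q) hspec
      _ = Qᵀ * (Q * diagonal hHerm.eigenvalues * Qᵀ) * Q := rfl
      _ = (Qᵀ * Q) * diagonal hHerm.eigenvalues * (Qᵀ * Q) := by simp only [Matrix.mul_assoc]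
      _ = _ := by rw [hQQ, Matrix.one_mul, Matrix.mul_one]
  have h0 : ∃ i, hHerm.eigenvalues i = 0 := by
    have h1 := hgdet b hbmem
    rw [hd, hdetb, Matrix.det_diagonal, Finset.prod_eq_zero_iff] at h1
    obtain ⟨i, _, hi⟩ := h1
    exact ⟨i, hi⟩
  have hCc : ∀ i j, ContDiff ℝ 1 (fun t => C t i j) := by
    intro i j
    simp only [hC, Matrix.mul_apply, Matrix.of_apply]
    exact ContDiff.sum fun k _ => (hgc i k).mul contDiff_const
  obtain ⟨δ, hδ, h1, h2⟩ := core C b hCc hHerm.eigenvalues hd h0 hb hhb hlim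
  have hmu : ∀ t ∈ Set.Icc a b, muNorm (A t) = muNorm (C t) := by
    intro t ht
    rw [hCA t ht, muNorm_mul_orth _ _ hQQ]
  refine ⟨min δ (b - a), lt_min hδ (sub_pos.2 hab), ?_, ?_⟩
  · refine (h1.mono (Set.Ioc_subset_Ioc_left (by linarith [min_le_left δ (b - a)]))).congr ?_
    intro t ht
    exact hmu t ⟨by linarith [ht.1, min_le_right δ (b - a)], ht.2⟩
  · refine h2.congr_of_eventuallyEq ?_ (hmu b hbmem)
    filter_upwards [Icc_mem_nhdsLE hab] with t ht
    exact hmu t ht
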